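/- Let L, R be 2×2 complex matrices with L*L + R*R = I. If L and R have two linearly independent common eigenvectors, then for any nonzero vector u₂ orthogonal to one of these common eigenvectors, u₂ is also a common eigenvector of both L and R. -/

import Mathlib

open Matrix

open scoped ComplexOrder in
theorem coin_self_zero (x : Fin 2 → ℂ) (h : star x ⬝ᵥ x = 0) : x = 0 :=
  dotProduct_star_self_eq_zero.1 h

theorem coin_inner (L R : Matrix (Fin 2) (Fin 2) ℂ)
    (hcoin : Lᴴ * L + Rᴴ * R = 1) (x y : Fin 2 → ℂ) (a b c e : ℂ)
    (h1 : L.mulVec x = a • x) (h2 : R.mulVec x = b • x)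
    (h3 : L.mulVec y = c • y) (h4 : R.mulVec y = e • y) :
    star x ⬝ᵥ y = (star a * c + star b * e) * (star x ⬝ᵥ y) := by
  have h : star x ⬝ᵥ ((Lᴴ * L + Rᴴ * R).mulVec y) = star x ⬝ᵥ y := by
    rw [hcoin, one_mulVec]
  rw [add_mulVec, ← mulVec_mulVec, ← mulVec_mulVec, dotProduct_add, dotProduct_mulVec _ Lᴴ,
    dotProduct_mulVec _ Rᴴ, ← star_mulVec, ← star_mulVec, h1, h2, h3, h4] at h
  simp only [star_smul, smul_dotProduct, dotProduct_smul, smul_eq_mul] at h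
  linear_combination -h

theorem coin_aux (L R : Matrix (Fin 2) (Fin 2) ℂ)
    (hcoin : Lᴴ * L + Rᴴ * R = 1)
    (u v : Fin 2 → ℂ)
    (hindep : LinearIndependent ℂ ![u, v])
    (hLu : ∃ a : ℂ, L.mulVec u = a • u) (hRu : ∃ b : ℂ, R.mulVec u = b • u)
    (hLv : ∃ c : ℂ, L.mulVec v = c • v) (hRv : ∃ e : ℂ, R.mulVec v = e • v)
    (u₂ : Fin 2 → ℂ)
    (horth : star u ⬝ᵥ u₂ = 0) :
    (∃ a : ℂ, L.mulVec u₂ = a • u₂) ∧ (∃ b : ℂ, R.mulVec u₂ = b • u₂) := by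
  obtain ⟨a, ha⟩ := hLu
  obtain ⟨b, hb⟩ := hRu
  obtain ⟨c, hc⟩ := hLv
  obtain ⟨e, he⟩ := hRv
  have hu : u ≠ 0 := by simpa using hindep.ne_zero 0
  have hv : v ≠ 0 := by simpa using hindep.ne_zero 1
  have hspan := hindep.span_eq_top_of_card_eq_finrank (by simp)
  have hmem : u₂ ∈ Submodule.span ℂ {u, v} := by
    have : Set.range ![u, v] = {u, v} := by simp [Matrix.range_cons, Matrix.range_empty, Set.pair_comm]
    rw [← this, hspan]; trivial
  obtain ⟨s, t, rfl⟩ := Submodule.mem_span_pair.1 hmem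
  have nu : star u ⬝ᵥ u ≠ 0 := fun h => hu (coin_self_zero _ h)
  have nv : star v ⬝ᵥ v ≠ 0 := fun h => hv (coin_self_zero _ h)
  by_cases huv : star u ⬝ᵥ v = 0
  · have hs : s = 0 := by
      rw [dotProduct_add, dotProduct_smul, dotProduct_smul, huv, smul_zero, add_zero,
        smul_eq_mul] at horth
      exact (mul_eq_zero.1 horth).resolve_right nu
    subst hs
    exact ⟨⟨c, by simp [mulVec_smul, hc, smul_comm t c]⟩,
      ⟨e, by simp [mulVec_smul, he, smul_comm t e]⟩⟩
  · have e1 : star a * a + star b * b = 1 :=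
      (mul_eq_right₀ nu).1 (coin_inner L R hcoin u u a b a b ha hb ha hb).symm
    have e2 : star c * c + star e * e = 1 :=
      (mul_eq_right₀ nv).1 (coin_inner L R hcoin v v c e c e hc he hc he).symm
    have e3 : star a * c + star b * e = 1 :=
      (mul_eq_right₀ huv).1 (coin_inner L R hcoin u v a b c e ha hb hc he).symm
    have e4 : star c * a + star e * b = 1 := by
      have := congrArg star e3
      simp only [star_add, star_mul, star_star, star_one] at this
      linear_combination this
    have key : star ![a - c, b - e] ⬝ᵥ ![a - c, b - e] = 0 := by
      simp only [dotProduct, Fin.sum_univ_two, Pi.star_apply, cons_val_zero, cons_val_one,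
        star_sub]
      linear_combination e1 + e2 - e3 - e4
    have k := coin_self_zero _ key
    have k0 : a = c := sub_eq_zero.1 (by simpa using congrFun k 0)
    have k1 : b = e := sub_eq_zero.1 (by simpa using congrFun k 1)
    subst k0 k1
    exact ⟨⟨a, by simp [mulVec_add, mulVec_smul, ha, hc, smul_comm _ a]⟩,
      ⟨b, by simp [mulVec_add, mulVec_smul, hb, he, smul_comm _ b]⟩⟩

theorem stmt1 (L R : Matrix (Fin 2) (Fin 2) ℂ)
    (hcoin : Lᴴ * L + Rᴴ * R = 1)
    (u v : Fin 2 → ℂ)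
    (hindep : LinearIndependent ℂ ![u, v])
    (hLu : ∃ a : ℂ, L.mulVec u = a • u) (hRu : ∃ b : ℂ, R.mulVec u = b • u)
    (hLv : ∃ c : ℂ, L.mulVec v = c • v) (hRv : ∃ e : ℂ, R.mulVec v = e • v)
    (u₂ : Fin 2 → ℂ) (hu₂ : u₂ ≠ 0)
    (horth : star u ⬝ᵥ u₂ = 0 ∨ star v ⬝ᵥ u₂ = 0) :
    (∃ a : ℂ, L.mulVec u₂ = a • u₂) ∧ (∃ b : ℂ, R.mulVec u₂ = b • u₂) := by
  rcases horth with h | h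
  · exact coin_aux L R hcoin u v hindep hLu hRu hLv hRv u₂ h
  · exact coin_aux L R hcoin v u (LinearIndependent.pair_symm_iff.1 hindep) hLv hRv hLu hRu u₂ h
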